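/- arXiv:2101.07651 — 2 statements merged into one kernel-verified Lean document; each statement's English description precedes it below -/
import Mathlib

section
/- Let z : (0,∞) → ℂ be measurable, let s ∈ ℂ be such that t ↦ |z(t)| · t^{Re(s)-1} is integrable on (0, ∞), and let k ≥ 2 be a natural number. Define Z(s) = ∫₀^∞ z(t) t^{s-1} dt. Then the k-fold iterated integral ∫₀^∞ dt ∫₀^∞ du₁ ⋯ ∫₀^∞ du_{k-1} t^{s-1} z(u₁) z(t/u_{k-1}) u₁^{-1} ∏_{j=1}^{k-2} z(u_{j+1}/u_j) u_{j+1}^{-1} converges absolutely and equals Z(s)^k. -/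
open MeasureTheory Set

lemma cpow_sub_one_mul_comp_div (z : ℝ → ℂ) (s : ℂ) {t v : ℝ} (ht : 0 < t) (hv : 0 < v) :
    (t : ℂ) ^ (s - 1) * z (t / v) =
      (v : ℂ) ^ (s - 1) * (z (v⁻¹ * t) * ((v⁻¹ * t : ℝ) : ℂ) ^ (s - 1)) := by
  have h : (t : ℂ) ^ (s - 1) = (v : ℂ) ^ (s - 1) * ((v⁻¹ * t : ℝ) : ℂ) ^ (s - 1) := by
    rw [← Complex.mul_cpow_ofReal_nonneg hv.le (by positivity), ← Complex.ofReal_mul,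
      mul_inv_cancel_left₀ hv.ne']
  rw [h, div_eq_inv_mul]
  ring

lemma cpow_sub_one_mul_self {v : ℝ} (hv : 0 < v) (s : ℂ) :
    (v : ℂ) ^ (s - 1) * v = (v : ℂ) ^ s := by
  have hv' : (v : ℂ) ≠ 0 := by exact_mod_cast hv.ne'
  rw [Complex.cpow_sub _ _ hv', Complex.cpow_one, div_mul_cancel₀ _ hv']

lemma integrableOn_cpow_mul_comp_div {z : ℝ → ℂ} {s : ℂ}
    (hf : IntegrableOn (fun t : ℝ => z t * (t : ℂ) ^ (s - 1)) (Ioi 0)) {v : ℝ} (hv : 0 < v) :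
    IntegrableOn (fun t : ℝ => (t : ℂ) ^ (s - 1) * z (t / v)) (Ioi 0) := by
  have h := (integrableOn_Ioi_comp_mul_left_iff
    (fun t : ℝ => z t * (t : ℂ) ^ (s - 1)) 0 (inv_pos.2 hv)).2 (by simpa using hf)
  refine IntegrableOn.congr_fun (h.const_mul ((v : ℂ) ^ (s - 1))) (fun t ht => ?_)
    measurableSet_Ioi
  exact (cpow_sub_one_mul_comp_div z s ht hv).symm

lemma integral_cpow_mul_comp_div (z : ℝ → ℂ) (s : ℂ) {v : ℝ} (hv : 0 < v) :
    ∫ t in Ioi (0 : ℝ), (t : ℂ) ^ (s - 1) * z (t / v) =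
      (v : ℂ) ^ s * ∫ t in Ioi (0 : ℝ), z t * (t : ℂ) ^ (s - 1) := by
  rw [setIntegral_congr_fun measurableSet_Ioi
    fun t ht => cpow_sub_one_mul_comp_div z s ht hv, integral_const_mul,
    integral_comp_mul_left_Ioi (fun t : ℝ => z t * (t : ℂ) ^ (s - 1)) 0 (inv_pos.2 hv),
    mul_zero, inv_inv, Complex.real_smul, ← mul_assoc, cpow_sub_one_mul_self hv]

lemma integral_norm_cpow_mul_comp_div (z : ℝ → ℂ) (s : ℂ) {v : ℝ} (hv : 0 < v) :
    ∫ t in Ioi (0 : ℝ), ‖(t : ℂ) ^ (s - 1) * z (t / v)‖ =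
      ‖(v : ℂ) ^ s‖ * ∫ t in Ioi (0 : ℝ), ‖z t * (t : ℂ) ^ (s - 1)‖ := by
  rw [setIntegral_congr_fun measurableSet_Ioi
    fun t ht => by rw [cpow_sub_one_mul_comp_div z s ht hv, norm_mul], integral_const_mul,
    integral_comp_mul_left_Ioi (fun t : ℝ => ‖z t * (t : ℂ) ^ (s - 1)‖) 0 (inv_pos.2 hv),
    mul_zero, inv_inv, smul_eq_mul, ← mul_assoc, ← cpow_sub_one_mul_self hv s, norm_mul,
    Complex.norm_of_nonneg hv.le]

section Convolution

variable {α : Type*} [MeasurableSpace α] {μ : Measure α} [SFinite μ] {z : ℝ → ℂ} {s : ℂ}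
  {G : α → ℂ} {v : α → ℝ}

lemma integrable_mellin_convolution (hz : Measurable z)
    (hf : IntegrableOn (fun t : ℝ => z t * (t : ℂ) ^ (s - 1)) (Ioi 0))
    (hG : Measurable G) (hv : Measurable v) (hpos : ∀ᵐ u ∂μ, 0 < v u)
    (h : Integrable (fun u => (v u : ℂ) ^ s * G u) μ) :
    Integrable (fun p : ℝ × α => (p.1 : ℂ) ^ (s - 1) * z (p.1 / v p.2) * G p.2)
      ((volume.restrict (Ioi 0)).prod μ) := by
  have hm : Measurable fun p : ℝ × α => (p.1 : ℂ) ^ (s - 1) * z (p.1 / v p.2) * G p.2 := by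
    fun_prop
  refine (integrable_prod_iff' hm.aestronglyMeasurable).2 ⟨?_, ?_⟩
  · filter_upwards [hpos] with u hu
    exact (integrableOn_cpow_mul_comp_div hf hu).mul_const (G u)
  · refine (h.norm.mul_const (∫ t in Ioi (0 : ℝ), ‖z t * (t : ℂ) ^ (s - 1)‖)).congr ?_
    filter_upwards [hpos] with u hu
    simp only [norm_mul _ (G u), integral_mul_const, integral_norm_cpow_mul_comp_div z s hu]
    ring

lemma integral_mellin_convolution (hz : Measurable z)
    (hf : IntegrableOn (fun t : ℝ => z t * (t : ℂ) ^ (s - 1)) (Ioi 0))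
    (hG : Measurable G) (hv : Measurable v) (hpos : ∀ᵐ u ∂μ, 0 < v u)
    (h : Integrable (fun u => (v u : ℂ) ^ s * G u) μ) :
    ∫ t in Ioi (0 : ℝ), ∫ u, (t : ℂ) ^ (s - 1) * z (t / v u) * G u ∂μ =
      (∫ u, (v u : ℂ) ^ s * G u ∂μ) * ∫ t in Ioi (0 : ℝ), z t * (t : ℂ) ^ (s - 1) := by
  rw [integral_integral_swap (integrable_mellin_convolution hz hf hG hv hpos h),
    ← integral_mul_const]
  refine integral_congr_ae ?_
  filter_upwards [hpos] with u hu
  rw [integral_mul_const, integral_cpow_mul_comp_div z s hu]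
  ring

end Convolution

/-- The chain kernel `z(u₀) u₀⁻¹ ∏ z(u_{j+1}/u_j) u_{j+1}⁻¹`. -/
noncomputable def ratioChain (z : ℝ → ℂ) (n : ℕ) (u : Fin (n + 1) → ℝ) : ℂ :=
  z (u 0) * (u 0 : ℂ)⁻¹ * ∏ j : Fin n, z (u j.succ / u j.castSucc) * (u j.succ : ℂ)⁻¹

lemma measurable_ratioChain {z : ℝ → ℂ} (hz : Measurable z) (n : ℕ) :
    Measurable (ratioChain z n) := by
  unfold ratioChain
  fun_prop

lemma ratioChain_snoc (z : ℝ → ℂ) (n : ℕ) (u : Fin (n + 1) → ℝ) (t : ℝ) :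
    ratioChain z (n + 1) (Fin.snoc (α := fun _ => ℝ) u t) =
      ratioChain z n u * (z (t / u (Fin.last n)) * (t : ℂ)⁻¹) := by
  have h0 : Fin.snoc (α := fun _ => ℝ) u t 0 = u 0 := by
    rw [← Fin.castSucc_zero, Fin.snoc_castSucc]
  simp only [ratioChain, Fin.prod_univ_castSucc (n := n), h0, Fin.snoc_castSucc, Fin.succ_last,
    Fin.snoc_last, ← Fin.castSucc_succ, mul_assoc]

lemma ae_pos_pi_restrict_Ioi (n : ℕ) (i : Fin n) :
    ∀ᵐ u ∂Measure.pi fun _ : Fin n => (volume : Measure ℝ).restrict (Ioi 0), 0 < u i :=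
  (Measure.quasiMeasurePreserving_eval _ i).ae (ae_restrict_mem measurableSet_Ioi)

lemma integrable_and_integral_ratioChain {z : ℝ → ℂ} {s : ℂ} (hz : Measurable z)
    (hf : IntegrableOn (fun t : ℝ => z t * (t : ℂ) ^ (s - 1)) (Ioi 0)) (n : ℕ) :
    Integrable (fun u => (u (Fin.last n) : ℂ) ^ s * ratioChain z n u)
      (Measure.pi fun _ => (volume : Measure ℝ).restrict (Ioi 0)) ∧
    ∫ u, (u (Fin.last n) : ℂ) ^ s * ratioChain z n u
      ∂(Measure.pi fun _ => (volume : Measure ℝ).restrict (Ioi 0)) =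
      (∫ t in Ioi (0 : ℝ), z t * (t : ℂ) ^ (s - 1)) ^ (n + 1) := by
  induction n with
  | zero =>
    have hmp := measurePreserving_funUnique ((volume : Measure ℝ).restrict (Ioi 0)) (Fin 1)
    have hae : (fun u : Fin 1 → ℝ => (u (Fin.last 0) : ℂ) ^ s * ratioChain z 0 u) =ᵐ[
        Measure.pi fun _ => (volume : Measure ℝ).restrict (Ioi 0)]
        fun u => (fun t : ℝ => z t * (t : ℂ) ^ (s - 1)) (MeasurableEquiv.funUnique (Fin 1) ℝ u) := by
      filter_upwards [ae_pos_pi_restrict_Ioi 1 0] with u hu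
      have hu' : (u 0 : ℂ) ≠ 0 := by exact_mod_cast hu.ne'
      rw [Fin.last_zero, ← cpow_sub_one_mul_self hu s]
      simp only [ratioChain, Finset.univ_eq_empty, Finset.prod_empty, mul_one,
        MeasurableEquiv.funUnique_apply, Fin.default_eq_zero]
      field_simp
    refine ⟨((hmp.integrable_comp_emb (MeasurableEquiv.measurableEmbedding _)).2 hf).congr
      hae.symm, ?_⟩
    rw [integral_congr_ae hae, zero_add, pow_one]
    exact hmp.integral_comp (MeasurableEquiv.measurableEmbedding _)
      fun t : ℝ => z t * (t : ℂ) ^ (s - 1)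
  | succ n ih =>
    have hpos := ae_pos_pi_restrict_Ioi (n + 1) (Fin.last n)
    have hI := integrable_mellin_convolution hz hf (measurable_ratioChain hz n)
      (measurable_pi_apply (Fin.last n)) hpos ih.1
    have hmp := measurePreserving_piFinSuccAbove
      (fun _ : Fin (n + 2) => (volume : Measure ℝ).restrict (Ioi 0)) (Fin.last (n + 1))
    have hae : (fun u : Fin (n + 2) → ℝ =>
        (u (Fin.last (n + 1)) : ℂ) ^ s * ratioChain z (n + 1) u) =ᵐ[
        Measure.pi fun _ => (volume : Measure ℝ).restrict (Ioi 0)]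
        fun u => (fun p : ℝ × (Fin (n + 1) → ℝ) => (p.1 : ℂ) ^ (s - 1) *
          z (p.1 / p.2 (Fin.last n)) * ratioChain z n p.2)
          (MeasurableEquiv.piFinSuccAbove (fun _ => ℝ) (Fin.last (n + 1)) u) := by
      filter_upwards [ae_pos_pi_restrict_Ioi (n + 2) (Fin.last (n + 1))] with u hu
      have hu' : (u (Fin.last (n + 1)) : ℂ) ≠ 0 := by exact_mod_cast hu.ne'
      have hsnoc := ratioChain_snoc z n (Fin.init (α := fun _ => ℝ) u) (u (Fin.last (n + 1)))
      rw [Fin.snoc_init_self] at hsnoc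
      have heq : MeasurableEquiv.piFinSuccAbove (fun _ => ℝ) (Fin.last (n + 1)) u =
          (u (Fin.last (n + 1)), Fin.init (α := fun _ => ℝ) u) := by
        refine Prod.ext rfl (funext fun i => ?_)
        simp [Fin.init]
      rw [heq, hsnoc, ← cpow_sub_one_mul_self hu s]
      simp only [Fin.init]
      field_simp
    refine ⟨((hmp.integrable_comp_emb (MeasurableEquiv.measurableEmbedding _)).2 hI).congr
      hae.symm, ?_⟩
    rw [integral_congr_ae hae, hmp.integral_comp (MeasurableEquiv.measurableEmbedding _)
      fun p : ℝ × (Fin (n + 1) → ℝ) => (p.1 : ℂ) ^ (s - 1) *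
          z (p.1 / p.2 (Fin.last n)) * ratioChain z n p.2, integral_prod _ hI,
      integral_mellin_convolution hz hf (measurable_ratioChain hz n)
      (measurable_pi_apply (Fin.last n)) hpos ih.1, ih.2, ← pow_succ]

/-- Mellin convolution theorem for the `k`-th power (`k ≥ 2`): the `k`-fold iterated
integral `∫₀^∞ dt ∫₀^∞ du₁ ⋯ ∫₀^∞ du_{k-1}
  t^(s-1) z(u₁) z(t/u_{k-1}) u₁⁻¹ ∏_{j=1}^{k-2} z(u_{j+1}/u_j) u_{j+1}⁻¹`
converges absolutely and equals `Z(s)^k`, where `Z(s) = ∫₀^∞ z(t) t^(s-1) dt`.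
Here the variables `u₁, …, u_{k-1}` are encoded as `u : Fin (k-1) → ℝ` with
`uⱼ = u ⟨j-1, _⟩`, and the inner `k-1`-fold integral is taken with respect to the
product (pi) volume on `Fin (k-1) → ℝ` over the set `(0,∞)^{k-1}`. -/
theorem mellin_pow_eq_iterated_integral (z : ℝ → ℂ) (hz : Measurable z) (s : ℂ)
    (hint : IntegrableOn (fun t : ℝ => ‖z t‖ * t ^ (s.re - 1)) (Ioi (0 : ℝ)))
    (k : ℕ) (hk : 2 ≤ k) :
    IntegrableOn
      (fun p : ℝ × (Fin (k - 1) → ℝ) =>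
        (p.1 : ℂ) ^ (s - 1) * z (p.2 ⟨0, by omega⟩) * z (p.1 / p.2 ⟨k - 2, by omega⟩) *
          ((p.2 ⟨0, by omega⟩ : ℝ) : ℂ)⁻¹ *
          ∏ j : Fin (k - 2),
            z (p.2 ⟨j.1 + 1, by omega⟩ / p.2 ⟨j.1, by omega⟩) *
              ((p.2 ⟨j.1 + 1, by omega⟩ : ℝ) : ℂ)⁻¹)
      (Ioi (0 : ℝ) ×ˢ univ.pi fun _ : Fin (k - 1) => Ioi (0 : ℝ)) ∧
    (∫ t in Ioi (0 : ℝ), ∫ u in univ.pi fun _ : Fin (k - 1) => Ioi (0 : ℝ),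
        (t : ℂ) ^ (s - 1) * z (u ⟨0, by omega⟩) * z (t / u ⟨k - 2, by omega⟩) *
          ((u ⟨0, by omega⟩ : ℝ) : ℂ)⁻¹ *
          ∏ j : Fin (k - 2),
            z (u ⟨j.1 + 1, by omega⟩ / u ⟨j.1, by omega⟩) *
              ((u ⟨j.1 + 1, by omega⟩ : ℝ) : ℂ)⁻¹) =
      (∫ t in Ioi (0 : ℝ), z t * (t : ℂ) ^ (s - 1)) ^ k := by
  obtain ⟨n, rfl⟩ : ∃ n, k = n + 2 := ⟨k - 2, by omega⟩
  have hf : IntegrableOn (fun t : ℝ => z t * (t : ℂ) ^ (s - 1)) (Ioi 0) := by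
    have hm : Measurable fun t : ℝ => z t * (t : ℂ) ^ (s - 1) := by fun_prop
    refine Integrable.mono' hint hm.aestronglyMeasurable ?_
    filter_upwards [ae_restrict_mem measurableSet_Ioi] with t ht
    rw [norm_mul, Complex.norm_cpow_eq_rpow_re_of_pos ht, Complex.sub_re, Complex.one_re]
  have hpos := ae_pos_pi_restrict_Ioi (n + 1) (Fin.last n)
  obtain ⟨hH, hval⟩ := integrable_and_integral_ratioChain hz hf n
  have hrestrict : (volume : Measure (Fin (n + 1) → ℝ)).restrict
      (univ.pi fun _ : Fin (n + 1) => Ioi (0 : ℝ)) =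
      Measure.pi fun _ => (volume : Measure ℝ).restrict (Ioi 0) :=
    Measure.restrict_pi_pi _ _
  have hkernel (t : ℝ) (u : Fin (n + 1) → ℝ) :
      (t : ℂ) ^ (s - 1) * z (u 0) * z (t / u (Fin.last n)) * ((u 0 : ℝ) : ℂ)⁻¹ *
        ∏ j : Fin n, z (u j.succ / u j.castSucc) * ((u j.succ : ℝ) : ℂ)⁻¹ =
      (t : ℂ) ^ (s - 1) * z (t / u (Fin.last n)) * ratioChain z n u := by
    rw [ratioChain]
    ring
  constructor
  · have hI := integrable_mellin_convolution hz hf (measurable_ratioChain hz n)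
      (measurable_pi_apply (Fin.last n)) hpos hH
    rw [← hrestrict, Measure.prod_restrict] at hI
    exact hI.congr (.of_forall fun p => (hkernel p.1 p.2).symm)
  · have hconv := integral_mellin_convolution hz hf (measurable_ratioChain hz n)
      (measurable_pi_apply (Fin.last n)) hpos hH
    rw [hval, ← pow_succ, ← hrestrict] at hconv
    rw [← hconv]
    exact integral_congr_ae (.of_forall fun t =>
      integral_congr_ae (.of_forall fun u => hkernel t u))
end

section
/- For every complex number x with -π/2 < Im(x) < 0, the function t ↦ (t^{2ix/π} - 1)/(t² - 1) is integrable on (0, ∞) and tanh(x) = -(2i/π) · ∫₀^∞ (t^{2ix/π} - 1)/(t² - 1) dt. -/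
open MeasureTheory Set

/-- On the closed left half-plane the exponential is `1`-Lipschitz at the origin. -/
lemma Complex.norm_exp_sub_one_le_norm_of_re_nonpos {w : ℂ} (hw : w.re ≤ 0) :
    ‖Complex.exp w - 1‖ ≤ ‖w‖ := by
  have key := Convex.norm_image_sub_le_of_norm_deriv_le (𝕜 := ℂ) (f := Complex.exp)
    (s := {z : ℂ | z.re ≤ 0}) (x := 0) (y := w) (C := 1)
    (fun z _ => Complex.differentiableAt_exp)
    (fun z hz => by
      rw [Complex.deriv_exp, Complex.norm_exp]
      exact Real.exp_le_one_iff.mpr hz)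
    (convex_halfSpace_re_le 0) (by simp) hw
  simpa using key

lemma Real.neg_log_le_rpow_mul_one_sub {ε t : ℝ} (hε : 0 < ε) (hε1 : ε ≤ 1) (ht : 0 < t)
    (ht1 : t ≤ 1) : -Real.log t ≤ ε⁻¹ * (t ^ (-ε) * (1 - t)) := by
  have h1 : Real.log (t ^ (-ε)) ≤ t ^ (-ε) - 1 :=
    Real.log_le_sub_one_of_pos (Real.rpow_pos_of_pos ht _)
  rw [Real.log_rpow ht] at h1
  have h2 : t ^ (-ε) * t ≤ 1 := by
    rw [← Real.rpow_add_one ht.ne']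
    exact Real.rpow_le_one ht.le ht1 (by linarith)
  rw [inv_mul_eq_div, le_div_iff₀ hε]
  linarith

lemma Complex.norm_ofReal_cpow_sub_one_le {s : ℂ} {ε t : ℝ} (hs : 0 ≤ s.re) (hε : 0 < ε)
    (hε1 : ε ≤ 1) (ht : 0 < t) (ht1 : t ≤ 1) :
    ‖(t : ℂ) ^ s - 1‖ ≤ ‖s‖ * ε⁻¹ * t ^ (-ε) * (1 - t) := by
  have hlog : Real.log t ≤ 0 := Real.log_nonpos ht.le ht1
  rw [Complex.cpow_def_of_ne_zero (by exact_mod_cast ht.ne'), ← Complex.ofReal_log ht.le]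
  calc _ ≤ ‖(Real.log t : ℂ) * s‖ := by
        apply Complex.norm_exp_sub_one_le_norm_of_re_nonpos
        rw [Complex.re_ofReal_mul]
        exact mul_nonpos_of_nonpos_of_nonneg hlog hs
    _ = ‖s‖ * (-Real.log t) := by
        rw [norm_mul, Complex.norm_real, Real.norm_of_nonpos hlog, mul_comm]
    _ ≤ ‖s‖ * (ε⁻¹ * (t ^ (-ε) * (1 - t))) := by
        gcongr
        exact Real.neg_log_le_rpow_mul_one_sub hε hε1 ht ht1
    _ = _ := by ring

/-- The partial fraction expansion of the tangent. -/
lemma hasSum_tan_pi_mul_half {s : ℂ} (hs : 0 < s.re) (hs1 : s.re < 1) :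
    HasSum (fun n : ℕ => 1 / (2 * n + 1 - s) - 1 / (2 * n + 1 + s))
      (Real.pi / 2 * Complex.tan (Real.pi * s / 2)) := by
  have hmem : ∀ z : ℂ, 0 < z.re → z.re < 1 → z ∈ Complex.integerComplement := by
    rintro z h0 h1 ⟨m, rfl⟩
    simp only [Complex.intCast_re] at h0 h1
    have h0 : (0 : ℤ) < m := by exact_mod_cast h0
    have h1 : m < (1 : ℤ) := by exact_mod_cast h1
    omega
  have m1 := hmem s hs hs1
  have hre : (s / 2).re = s.re / 2 := by simp
  have m2 := hmem (s / 2) (by rw [hre]; linarith) (by rw [hre]; linarith)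
  have H1 : HasSum (cotTerm s) (Real.pi * (Real.pi * s).cot - 1 / s) := by
    rw [cot_series_rep' m1]
    exact (summable_cotTerm m1).hasSum
  have H2 : HasSum (cotTerm (s / 2))
      (Real.pi * (Real.pi * (s / 2)).cot - 1 / (s / 2)) := by
    rw [cot_series_rep' m2]
    exact (summable_cotTerm m2).hasSum
  have H3 : HasSum (fun k => cotTerm s (2 * k + 1))
      (1 / 2 * (Real.pi * (Real.pi * (s / 2)).cot - 1 / (s / 2))) := by
    refine (H2.mul_left (1 / 2)).congr_fun fun k => ?_
    have e1 : s - ((2 * k + 1 : ℕ) + 1) = 2 * (s / 2 - (k + 1)) := by push_cast; ring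
    have e2 : s + ((2 * k + 1 : ℕ) + 1) = 2 * (s / 2 + (k + 1)) := by push_cast; ring
    simp only [cotTerm, one_div]
    rw [e1, e2, mul_inv, mul_inv, mul_add]
  have H4 : HasSum (fun k => cotTerm s (2 * k)) (∑' k, cotTerm s (2 * k)) :=
    ((summable_cotTerm m1).comp_injective (i := fun k : ℕ => 2 * k)
      (fun a b h => by simpa using h)).hasSum
  have hval := (H4.even_add_odd H3).unique H1
  have hs0 : s ≠ 0 := by rintro rfl; simp at hs
  have hsin : Complex.sin (Real.pi * (s / 2)) ≠ 0 := sin_pi_mul_ne_zero m2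
  have hsin2 : Complex.sin (Real.pi * s) ≠ 0 := sin_pi_mul_ne_zero m1
  have hdouble : Complex.sin (Real.pi * s) =
      2 * Complex.sin (Real.pi * (s / 2)) * Complex.cos (Real.pi * (s / 2)) := by
    rw [← Complex.sin_two_mul]; ring_nf
  have hdouble' : Complex.cos (Real.pi * s) =
      2 * Complex.cos (Real.pi * (s / 2)) ^ 2 - 1 := by
    rw [← Complex.cos_two_mul]; ring_nf
  have hcos : Complex.cos (Real.pi * (s / 2)) ≠ 0 := by
    intro h
    exact hsin2 (by rw [hdouble, h, mul_zero])
  have hA : ∑' k, cotTerm s (2 * k) = -(Real.pi / 2 * Complex.tan (Real.pi * (s / 2))) := by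
    rw [eq_sub_of_add_eq hval, Complex.cot, Complex.cot, Complex.tan, hdouble, hdouble']
    have hsc := Complex.sin_sq_add_cos_sq (Real.pi * (s / 2))
    generalize Complex.sin (Real.pi * (s / 2)) = a at *
    generalize Complex.cos (Real.pi * (s / 2)) = b at *
    field_simp
    linear_combination Real.pi * s * hsc
  rw [hA] at H4
  rw [mul_div_assoc, ← neg_neg (_ * Complex.tan _)]
  refine H4.neg.congr_fun fun k => ?_
  simp only [cotTerm]
  have e1 : s - ((2 * k : ℕ) + 1) = -(2 * k + 1 - s) := by push_cast; ring
  have e2 : s + ((2 * k : ℕ) + 1) = 2 * k + 1 + s := by push_cast; ring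
  rw [e1, e2, one_div_neg_eq_neg_one_div]
  ring

lemma integrableOn_cpow_neg_sub_one_div_Ioo {s : ℂ} (hs : 0 < s.re) (hs1 : s.re < 1) :
    IntegrableOn (fun t : ℝ => ((t : ℂ) ^ (-s) - 1) / (1 - (t : ℂ) ^ 2)) (Ioo 0 1) ∧
    IntegrableOn (fun t : ℝ => ((t : ℂ) ^ s - 1) / ((t : ℂ) ^ 2 - 1)) (Ioo 0 1) := by
  set ε : ℝ := (1 - s.re) / 2 with hε
  have hε0 : 0 < ε := by linarith
  have hε1 : ε ≤ 1 := by linarith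
  have hden : ∀ t : ℝ, t ∈ Ioo (0 : ℝ) 1 → 1 - t ≤ ‖1 - (t : ℂ) ^ 2‖ := by
    intro t ht
    have : (1 - (t : ℂ) ^ 2) = ((1 - t ^ 2 : ℝ) : ℂ) := by push_cast; ring
    rw [this, Complex.norm_real]
    refine le_trans ?_ (le_abs_self _)
    nlinarith [ht.1, ht.2]
  have hint : ∀ a : ℝ, -1 < a → IntegrableOn (fun t : ℝ => ‖s‖ * ε⁻¹ * t ^ a) (Ioo 0 1) :=
    fun a ha => ((intervalIntegral.integrableOn_Ioo_rpow_iff one_pos).mpr ha).const_mul _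
  constructor
  · refine Integrable.mono' (hint (-s.re - ε) (by linarith))
      (by fun_prop : Measurable _).aestronglyMeasurable ?_
    refine (ae_restrict_mem measurableSet_Ioo).mono fun t ht => ?_
    have ht' : (t : ℂ) ≠ 0 := by exact_mod_cast ht.1.ne'
    have h1t : 0 < 1 - t := by linarith [ht.2]
    have e : (t : ℂ) ^ (-s) - 1 = (t : ℂ) ^ (-s) * -((t : ℂ) ^ s - 1) := by
      have : (t : ℂ) ^ (-s) * (t : ℂ) ^ s = 1 := by
        rw [← Complex.cpow_add _ _ ht', neg_add_cancel, Complex.cpow_zero]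
      linear_combination this
    rw [norm_div, e, norm_mul, norm_neg, Complex.norm_cpow_eq_rpow_re_of_pos ht.1,
      Complex.neg_re, div_le_iff₀ (h1t.trans_le (hden t ht)), sub_eq_add_neg (-s.re),
      Real.rpow_add ht.1]
    calc _ ≤ t ^ (-s.re) * (‖s‖ * ε⁻¹ * t ^ (-ε) * (1 - t)) := by
          have := ht.1
          gcongr
          exact Complex.norm_ofReal_cpow_sub_one_le hs.le hε0 hε1 ht.1 ht.2.le
      _ = ‖s‖ * ε⁻¹ * (t ^ (-s.re) * t ^ (-ε)) * (1 - t) := by ring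
      _ ≤ _ := by
          have := ht.1
          gcongr
          exact hden t ht
  · refine Integrable.mono' (hint (-ε) (by linarith))
      (by fun_prop : Measurable _).aestronglyMeasurable ?_
    refine (ae_restrict_mem measurableSet_Ioo).mono fun t ht => ?_
    have h1t : 0 < 1 - t := by linarith [ht.2]
    rw [norm_div, norm_sub_rev ((t : ℂ) ^ 2), div_le_iff₀ (h1t.trans_le (hden t ht))]
    refine (Complex.norm_ofReal_cpow_sub_one_le hs.le hε0 hε1 ht.1 ht.2.le).trans ?_
    have := ht.1
    gcongr
    exact hden t ht

lemma integral_cpow_neg_sub_cpow_div_Ioo {s : ℂ} (hs : 0 < s.re) (hs1 : s.re < 1) :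
    ∫ t in Ioo (0 : ℝ) 1, ((t : ℂ) ^ (-s) - (t : ℂ) ^ s) / (1 - (t : ℂ) ^ 2) =
      Real.pi / 2 * Complex.tan (Real.pi * s / 2) := by
  set f : ℝ → ℂ := fun t => ((t : ℂ) ^ (-s) - (t : ℂ) ^ s) / (1 - (t : ℂ) ^ 2) with hf
  have hfi : IntegrableOn f (Ioo 0 1) := by
    obtain ⟨h1, h2⟩ := integrableOn_cpow_neg_sub_one_div_Ioo hs hs1
    refine (h1.add h2).congr (Filter.Eventually.of_forall fun t => ?_)
    simp only [Pi.add_apply, hf]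
    rw [← neg_sub 1 ((t : ℂ) ^ 2), div_neg]
    ring
  set F : ℕ → ℝ → ℂ := fun n t =>
    ((t : ℂ) ^ 2) ^ n * ((t : ℂ) ^ (-s) - (t : ℂ) ^ s) with hF
  have hsq : ∀ t : ℝ, t ∈ Ioo (0 : ℝ) 1 → t ^ 2 < 1 := fun t ht => by
    nlinarith [ht.1, ht.2]
  have hgeom : ∀ t : ℝ, t ∈ Ioo (0 : ℝ) 1 → HasSum (fun n => F n t) (f t) := by
    intro t ht
    have : ‖(t : ℂ) ^ 2‖ < 1 := by
      rw [norm_pow, Complex.norm_real, Real.norm_eq_abs, sq_abs]; exact hsq t ht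
    have := (hasSum_geometric_of_norm_lt_one this).mul_right ((t : ℂ) ^ (-s) - (t : ℂ) ^ s)
    rwa [inv_mul_eq_div] at this
  have hgeomn : ∀ t : ℝ, t ∈ Ioo (0 : ℝ) 1 → HasSum (fun n => ‖F n t‖) ‖f t‖ := by
    intro t ht
    have h := (hasSum_geometric_of_lt_one (sq_nonneg t) (hsq t ht)).mul_right
      ‖(t : ℂ) ^ (-s) - (t : ℂ) ^ s‖
    have hval : ‖f t‖ = (1 - t ^ 2)⁻¹ * ‖(t : ℂ) ^ (-s) - (t : ℂ) ^ s‖ := by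
      have : (1 - (t : ℂ) ^ 2) = ((1 - t ^ 2 : ℝ) : ℂ) := by push_cast; ring
      simp only [hf]
      rw [this, norm_div, Complex.norm_real,
        Real.norm_of_nonneg (by linarith [hsq t ht]), inv_mul_eq_div]
    rw [hval]
    exact h.congr_fun fun n => by simp [hF]
  have hsum : HasSum (fun n => ∫ t in Ioo (0 : ℝ) 1, F n t) (∫ t in Ioo (0 : ℝ) 1, f t) := by
    refine hasSum_integral_of_dominated_convergence (fun n t => ‖F n t‖)
      (fun n => (by fun_prop : Measurable (F n)).aestronglyMeasurable)
      (fun n => Filter.Eventually.of_forall fun t => le_rfl) ?_ ?_ ?_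
    · exact (ae_restrict_mem measurableSet_Ioo).mono fun t ht => (hgeomn t ht).summable
    · exact hfi.norm.congr
        ((ae_restrict_mem measurableSet_Ioo).mono fun t ht => (hgeomn t ht).tsum_eq.symm)
    · exact (ae_restrict_mem measurableSet_Ioo).mono hgeom
  refine (hsum.unique ?_)
  refine (hasSum_tan_pi_mul_half hs hs1).congr_fun fun n => ?_
  have hn : (0 : ℝ) ≤ 2 * n := by positivity
  have r1 : -1 < (2 * n - s : ℂ).re := by simp; linarith
  have r2 : -1 < (2 * n + s : ℂ).re := by simp; linarith
  have z1 : (2 * n - s + 1 : ℂ) ≠ 0 := by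
    intro h; have := congrArg Complex.re h; simp at this; linarith
  have z2 : (2 * n + s + 1 : ℂ) ≠ 0 := by
    intro h; have := congrArg Complex.re h; simp at this; linarith
  calc ∫ t in Ioo (0 : ℝ) 1, F n t
      = ∫ t in Ioo (0 : ℝ) 1, ((t : ℂ) ^ (2 * n - s : ℂ) - (t : ℂ) ^ (2 * n + s : ℂ)) := by
        refine setIntegral_congr_fun measurableSet_Ioo fun t ht => ?_
        have ht' : (t : ℂ) ≠ 0 := by exact_mod_cast ht.1.ne'
        have hp : (t : ℂ) ^ (2 * n : ℂ) = ((t : ℂ) ^ 2) ^ n := by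
          rw [← pow_mul, ← Complex.cpow_natCast]; push_cast; rfl
        simp only [hF]
        rw [sub_eq_add_neg (2 * n : ℂ), Complex.cpow_add _ _ ht', Complex.cpow_add _ _ ht', hp]
        ring
    _ = ∫ t in (0 : ℝ)..1, ((t : ℂ) ^ (2 * n - s : ℂ) - (t : ℂ) ^ (2 * n + s : ℂ)) := by
        rw [intervalIntegral.integral_of_le zero_le_one, integral_Ioc_eq_integral_Ioo]
    _ = _ := by
        rw [intervalIntegral.integral_sub (intervalIntegral.intervalIntegrable_cpow' r1)
          (intervalIntegral.intervalIntegrable_cpow' r2), integral_cpow (Or.inl r1),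
          integral_cpow (Or.inl r2)]
        simp only [Complex.ofReal_one, Complex.one_cpow, Complex.ofReal_zero,
          Complex.zero_cpow z1, Complex.zero_cpow z2, sub_zero]
        congr 2 <;> ring

lemma integral_cpow_sub_one_div_sq_sub_one {s : ℂ} (hs : 0 < s.re) (hs1 : s.re < 1) :
    IntegrableOn (fun t : ℝ => ((t : ℂ) ^ s - 1) / ((t : ℂ) ^ 2 - 1)) (Ioi 0) ∧
    ∫ t in Ioi (0 : ℝ), ((t : ℂ) ^ s - 1) / ((t : ℂ) ^ 2 - 1) =
      Real.pi / 2 * Complex.tan (Real.pi * s / 2) := by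
  set h : ℝ → ℂ := fun t => ((t : ℂ) ^ s - 1) / ((t : ℂ) ^ 2 - 1) with hh
  set g : ℝ → ℂ := fun t => ((t : ℂ) ^ (-s) - 1) / (1 - (t : ℂ) ^ 2) with hg
  obtain ⟨hgi, hhi⟩ := integrableOn_cpow_neg_sub_one_div_Ioo hs hs1
  have himg : (fun t : ℝ => t⁻¹) '' Ioo 0 1 = Ioi 1 := by
    rw [Set.image_inv_eq_inv, Set.inv_Ioo_0_left one_pos, inv_one]
  have hderiv : ∀ t ∈ Ioo (0 : ℝ) 1,
      HasDerivWithinAt (fun t : ℝ => t⁻¹) (-(t ^ 2)⁻¹) (Ioo 0 1) t :=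
    fun t ht => (hasDerivAt_inv ht.1.ne').hasDerivWithinAt
  have hinj : InjOn (fun t : ℝ => t⁻¹) (Ioo 0 1) := inv_injective.injOn
  have hinv : EqOn (fun t : ℝ => |(-(t ^ 2)⁻¹)| • h t⁻¹) g (Ioo 0 1) := by
    intro t ht
    have ht' : (t : ℂ) ≠ 0 := by exact_mod_cast ht.1.ne'
    have hd : (1 : ℂ) - (t : ℂ) ^ 2 ≠ 0 := by
      have : (1 : ℝ) - t ^ 2 ≠ 0 := by nlinarith [ht.1, ht.2]
      exact_mod_cast this
    have hpow : ((t⁻¹ : ℝ) : ℂ) ^ s = (t : ℂ) ^ (-s) := by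
      rw [Complex.ofReal_inv, Complex.inv_cpow _ _ (by
        rw [Complex.arg_ofReal_of_nonneg ht.1.le]; exact Real.pi_pos.ne), Complex.cpow_neg]
    have hd' : ((t : ℂ)⁻¹ ^ 2 - 1) = (1 - (t : ℂ) ^ 2) / (t : ℂ) ^ 2 := by field_simp
    simp only [hh, hg]
    rw [hpow, abs_neg, abs_of_nonneg (by positivity), Complex.real_smul, Complex.ofReal_inv t, hd']
    push_cast
    field_simp
  have hhi1 : IntegrableOn h (Ioi 1) := by
    rw [← himg, integrableOn_image_iff_integrableOn_abs_deriv_smul measurableSet_Ioo hderiv hinj]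
    exact hgi.congr_fun hinv.symm measurableSet_Ioo
  have hint1 : ∫ t in Ioi (1 : ℝ), h t = ∫ t in Ioo (0 : ℝ) 1, g t := by
    rw [← himg, integral_image_eq_integral_abs_deriv_smul measurableSet_Ioo hderiv hinj]
    exact setIntegral_congr_fun measurableSet_Ioo hinv
  have hhi' : IntegrableOn h (Ioc 0 1) := (integrableOn_Ioc_iff_integrableOn_Ioo).mpr hhi
  have hunion : Ioc (0 : ℝ) 1 ∪ Ioi 1 = Ioi 0 := Ioc_union_Ioi_eq_Ioi zero_le_one
  refine ⟨hunion ▸ hhi'.union hhi1, ?_⟩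
  rw [← hunion, setIntegral_union (Ioc_disjoint_Ioi le_rfl) measurableSet_Ioi hhi' hhi1, hint1,
    integral_Ioc_eq_integral_Ioo, ← integral_add hhi hgi,
    ← integral_cpow_neg_sub_cpow_div_Ioo hs hs1]
  refine setIntegral_congr_fun measurableSet_Ioo fun t _ => ?_
  rw [← neg_sub 1 ((t : ℂ) ^ 2), div_neg]
  ring

/-- Integral representation of `tanh`: for `-π/2 < Im x < 0`, the function
`t ↦ (t^(2ix/π) - 1)/(t² - 1)` is integrable on `(0,∞)` and
`tanh x = -(2i/π) ∫₀^∞ (t^(2ix/π) - 1)/(t² - 1) dt`. -/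
theorem tanh_eq_integral (x : ℂ) (h1 : -(Real.pi / 2) < x.im) (h2 : x.im < 0) :
    IntegrableOn
      (fun t : ℝ =>
        ((t : ℂ) ^ (2 * Complex.I * x / (Real.pi : ℂ)) - 1) / ((t : ℂ) ^ 2 - 1))
      (Ioi (0 : ℝ)) ∧
    Complex.tanh x = -(2 * Complex.I / (Real.pi : ℂ)) *
      ∫ t in Ioi (0 : ℝ),
        ((t : ℂ) ^ (2 * Complex.I * x / (Real.pi : ℂ)) - 1) / ((t : ℂ) ^ 2 - 1) := by

  set s : ℂ := 2 * Complex.I * x / (Real.pi : ℂ) with hs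
  have hpi := Real.pi_pos
  have hpi' : (Real.pi : ℂ) ≠ 0 := by exact_mod_cast hpi.ne'
  have hre : s.re = -(2 * x.im) / Real.pi := by
    rw [hs, Complex.div_ofReal_re]
    simp
  have h0 : 0 < s.re := by
    rw [hre]
    exact div_pos (by linarith) hpi
  have h1' : s.re < 1 := by
    rw [hre, div_lt_one hpi]
    linarith
  obtain ⟨hi, hv⟩ := integral_cpow_sub_one_div_sq_sub_one h0 h1'
  refine ⟨hi, ?_⟩
  have harg : Real.pi * s / 2 = x * Complex.I := by
    rw [hs]
    field_simp
  rw [hv, harg, Complex.tan_mul_I]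
  field_simp
  linear_combination Complex.tanh x * Complex.I_sq
end
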